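/- Key nonlinear estimate in the stability proof: Let N ≥ 1, M ≥ 0, and let v, w ∈ S_N be trigonometric polynomials with ‖v'‖_∞ ≤ M and ‖w'‖_∞ ≤ M. Let P ∈ S_N be the unique element of S_N with nodal values P(x_j) = (v'(x_j))² − (w'(x_j))² for j = 0,…,2N−1 (i.e. P = I_N((v')² − (w')²)), and set e = v − w. Then |∫₀^{2π} P(x) conj(e(x)) dx| ≤ 2M ‖e'‖ ‖e‖. -/

import Mathlib

open Real MeasureTheory

noncomputable section

/-- Equispaced nodes `x_j = jπ/N`. -/
def node (N : ℕ) (j : ℕ) : ℝ := j * Real.pi / N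

/-- The trigonometric polynomial `x ↦ Σ_{k=-N}^{N-1} c_k e^{ikx}`. -/
def trigPoly (N : ℕ) (c : ℤ → ℂ) : ℝ → ℂ := fun x =>
  ∑ k ∈ Finset.Icc (-(N : ℤ)) ((N : ℤ) - 1), c k * Complex.exp (Complex.I * k * x)

/-- Membership in the space `S_N` of trigonometric polynomials of degree `N`. -/
def memSN (N : ℕ) (v : ℝ → ℂ) : Prop := ∃ c : ℤ → ℂ, v = trigPoly N c

/-- Discrete Fourier transform coefficients of `u` at the `2N` equispaced nodes. -/
def dftCoeff (N : ℕ) (u : ℝ → ℂ) (k : ℤ) : ℂ :=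
  (1 / (2 * N : ℂ)) *
    ∑ j ∈ Finset.range (2 * N), u (node N j) * Complex.exp (-(Complex.I * k * node N j))

/-- The trigonometric interpolant `I_N(u) ∈ S_N` of `u` at the equispaced nodes. -/
def interp (N : ℕ) (u : ℝ → ℂ) : ℝ → ℂ := trigPoly N (dftCoeff N u)

/-- The `L²(0, 2π)` norm. -/
def l2norm {E : Type*} [NormedAddCommGroup E] (v : ℝ → E) : ℝ :=
  Real.sqrt (∫ x in (0:ℝ)..(2 * Real.pi), ‖v x‖ ^ 2)

/-- The sup norm over `[0, 2π]`. -/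
def supNorm {E : Type*} [NormedAddCommGroup E] (v : ℝ → E) : ℝ :=
  ⨆ x : Set.Icc (0:ℝ) (2 * Real.pi), ‖v x.1‖

/-- `u` has the (pointwise convergent) Fourier expansion with coefficients `c`. -/
def hasFourierCoeffs (u : ℝ → ℂ) (c : ℤ → ℂ) : Prop :=
  ∀ x : ℝ, HasSum (fun k : ℤ => c k * Complex.exp (Complex.I * k * x)) (u x)

/-- Membership in the periodic Sobolev space `H^m_p`, expressed via Fourier coefficients. -/
def inHp (m : ℕ) (c : ℤ → ℂ) : Prop :=
  Summable fun k : ℤ => (|k| : ℝ) ^ (2 * m) * ‖c k‖ ^ 2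

/-- `‖∂^m u/∂x^m‖ = (2π Σ_k |k|^{2m}|c_k|²)^{1/2}` for `u` with Fourier coefficients `c`. -/
def sobNorm (m : ℕ) (c : ℤ → ℂ) : ℝ :=
  Real.sqrt (2 * Real.pi * ∑' k : ℤ, (|k| : ℝ) ^ (2 * m) * ‖c k‖ ^ 2)

lemma continuous_trigPoly (N : ℕ) (c : ℤ → ℂ) : Continuous (trigPoly N c) := by
  unfold trigPoly
  fun_prop

lemma trigPoly_sub (N : ℕ) (a b : ℤ → ℂ) :
    (fun x => trigPoly N a x - trigPoly N b x) = trigPoly N (fun k => a k - b k) := by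
  funext x
  simp only [trigPoly, sub_mul, Finset.sum_sub_distrib]

lemma deriv_trigPoly (N : ℕ) (c : ℤ → ℂ) :
    deriv (trigPoly N c) = trigPoly N (fun k => Complex.I * k * c k) := by
  funext x
  refine HasDerivAt.deriv ?_
  unfold trigPoly
  refine HasDerivAt.fun_sum fun k _ => ?_
  have h := (((Complex.ofRealCLM.hasDerivAt (x := x)).const_mul
    (Complex.I * k)).cexp).const_mul (c k)
  simp only [Complex.ofRealCLM_apply, Complex.ofReal_one] at h
  refine h.congr_deriv ?_
  ring

lemma conj_exp_I_mul (k : ℤ) (x : ℝ) :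
    (starRingEnd ℂ) (Complex.exp (Complex.I * k * x)) = Complex.exp (-(Complex.I * k * x)) := by
  rw [← Complex.exp_conj]
  simp

lemma integral_exp_int_mul (m : ℤ) :
    ∫ x in (0:ℝ)..(2 * Real.pi), Complex.exp (Complex.I * m * x) =
      if m = 0 then 2 * (Real.pi : ℂ) else 0 := by
  split_ifs with h
  · simp [h]
  · have hm : Complex.I * (m : ℂ) ≠ 0 := mul_ne_zero Complex.I_ne_zero (Int.cast_ne_zero.mpr h)
    have h1 : Complex.exp (Complex.I * m * ((2 * Real.pi : ℝ) : ℂ)) = 1 :=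
      Complex.exp_eq_one_iff.mpr ⟨m, by push_cast; ring⟩
    rw [integral_exp_mul_complex hm, h1]
    simp

/-- Parseval's identity for trigonometric polynomials. -/
lemma integral_trigPoly_mul_conj (N : ℕ) (a b : ℤ → ℂ) :
    ∫ x in (0:ℝ)..(2 * Real.pi), trigPoly N a x * (starRingEnd ℂ) (trigPoly N b x) =
      2 * Real.pi *
        ∑ k ∈ Finset.Icc (-(N : ℤ)) ((N : ℤ) - 1), a k * (starRingEnd ℂ) (b k) := by
  have hexpand : ∀ x : ℝ, trigPoly N a x * (starRingEnd ℂ) (trigPoly N b x) =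
      ∑ k ∈ Finset.Icc (-(N : ℤ)) ((N : ℤ) - 1), ∑ l ∈ Finset.Icc (-(N : ℤ)) ((N : ℤ) - 1),
        a k * (starRingEnd ℂ) (b l) * Complex.exp (Complex.I * ((k - l : ℤ) : ℂ) * x) := by
    intro x
    simp only [trigPoly, map_sum, map_mul, conj_exp_I_mul, Finset.sum_mul_sum]
    refine Finset.sum_congr rfl fun k _ => Finset.sum_congr rfl fun l _ => ?_
    have : Complex.I * ((k - l : ℤ) : ℂ) * x = Complex.I * k * x + -(Complex.I * l * x) := by
      push_cast; ring
    rw [this, Complex.exp_add]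
    ring
  simp only [hexpand]
  rw [intervalIntegral.integral_finsetSum fun k _ =>
    Continuous.intervalIntegrable (by fun_prop) _ _, Finset.mul_sum]
  refine Finset.sum_congr rfl fun k hk => ?_
  rw [intervalIntegral.integral_finsetSum fun l _ =>
    Continuous.intervalIntegrable (by fun_prop) _ _]
  simp only [intervalIntegral.integral_const_mul, integral_exp_int_mul, sub_eq_zero]
  simp only [mul_ite, mul_zero, Finset.sum_ite_eq, hk, if_true]
  ring

/-- Discrete orthogonality of the exponentials at the equispaced nodes. -/
lemma sum_exp_node (N : ℕ) (hN : 1 ≤ N) (m : ℤ) (hm : |m| < 2 * N) :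
    ∑ j ∈ Finset.range (2 * N), Complex.exp (Complex.I * m * node N j) =
      if m = 0 then 2 * (N : ℂ) else 0 := by
  split_ifs with h
  · simp [h]
  have hN0 : (N : ℂ) ≠ 0 := Nat.cast_ne_zero.mpr (by omega)
  have hpi : (Real.pi : ℂ) ≠ 0 := Complex.ofReal_ne_zero.mpr Real.pi_ne_zero
  set z : ℂ := Complex.exp (Complex.I * m * (Real.pi / N)) with hz
  have hpow : ∀ j : ℕ, Complex.exp (Complex.I * m * node N j) = z ^ j := by
    intro j
    rw [hz, ← Complex.exp_nat_mul]
    congr 1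
    simp only [node]
    push_cast
    ring
  have hz1 : z ≠ 1 := by
    intro hz1
    obtain ⟨n, hn⟩ := Complex.exp_eq_one_iff.mp hz1
    have h2 : (m : ℂ) = 2 * N * n := by
      have hI := Complex.I_ne_zero
      field_simp at hn
      linear_combination hn
    have h3 : m = 2 * N * n := by exact_mod_cast h2
    have hn0 : n ≠ 0 := by rintro rfl; simp at h3; exact h h3
    have h4 : 1 ≤ |n| := Int.one_le_abs hn0
    rw [h3, abs_mul, abs_of_nonneg (by positivity : (0 : ℤ) ≤ 2 * N)] at hm
    nlinarith
  have hzN : z ^ (2 * N) = 1 := by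
    rw [hz, ← Complex.exp_nat_mul]
    refine Complex.exp_eq_one_iff.mpr ⟨m, ?_⟩
    push_cast
    field_simp
  simp only [hpow]
  rw [geom_sum_eq hz1, hzN]
  simp

/-- Interpolation reproduces the elements of `S_N`. -/
lemma interp_trigPoly (N : ℕ) (hN : 1 ≤ N) (c : ℤ → ℂ) :
    interp N (trigPoly N c) = trigPoly N c := by
  have hN0 : (N : ℂ) ≠ 0 := Nat.cast_ne_zero.mpr (by omega)
  funext x
  simp only [interp]
  unfold trigPoly
  refine Finset.sum_congr rfl fun k hk => ?_
  congr 1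
  simp only [dftCoeff, Finset.sum_mul]
  rw [Finset.sum_comm]
  have hinner : ∀ l ∈ Finset.Icc (-(N : ℤ)) ((N : ℤ) - 1),
      ∑ j ∈ Finset.range (2 * N), c l * Complex.exp (Complex.I * l * node N j) *
        Complex.exp (-(Complex.I * k * node N j)) = if k = l then c l * (2 * N) else 0 := by
    intro l hl
    have hlt : |l - k| < 2 * N := by
      rw [Finset.mem_Icc] at hk hl
      rw [abs_lt]
      omega
    have h := sum_exp_node N hN (l - k) hlt
    simp only [sub_eq_zero, eq_comm (a := l)] at h
    rw [← mul_zero (c l), ← mul_ite, ← h, Finset.mul_sum]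
    refine Finset.sum_congr rfl fun j _ => ?_
    rw [mul_assoc, ← Complex.exp_add]
    congr 2
    push_cast
    ring
  rw [Finset.sum_congr rfl hinner]
  simp only [Finset.sum_ite_eq, hk, if_true]
  field_simp

/-- The `L²` pairing of an interpolant with an element of `S_N` is the discrete inner product. -/
lemma integral_interp_mul_conj (N : ℕ) (hN : 1 ≤ N) (u : ℝ → ℂ) (b : ℤ → ℂ) :
    ∫ x in (0:ℝ)..(2 * Real.pi), interp N u x * (starRingEnd ℂ) (trigPoly N b x) =
      (Real.pi / N : ℝ) * ∑ j ∈ Finset.range (2 * N),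
        u (node N j) * (starRingEnd ℂ) (trigPoly N b (node N j)) := by
  have hN0 : (N : ℂ) ≠ 0 := Nat.cast_ne_zero.mpr (by omega)
  rw [interp, integral_trigPoly_mul_conj]
  simp only [dftCoeff, trigPoly, map_sum, map_mul, conj_exp_I_mul, Finset.mul_sum, Finset.sum_mul]
  rw [Finset.sum_comm]
  refine Finset.sum_congr rfl fun j _ => Finset.sum_congr rfl fun k _ => ?_
  push_cast
  field_simp

lemma integral_norm_sq_trigPoly (N : ℕ) (hN : 1 ≤ N) (b : ℤ → ℂ) :
    ∫ x in (0:ℝ)..(2 * Real.pi), ‖trigPoly N b x‖ ^ 2 =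
      Real.pi / N * ∑ j ∈ Finset.range (2 * N), ‖trigPoly N b (node N j)‖ ^ 2 := by
  have h := integral_interp_mul_conj N hN (trigPoly N b) b
  simp only [interp_trigPoly N hN, Complex.mul_conj'] at h
  simp only [← Complex.ofReal_pow] at h
  rw [intervalIntegral.integral_ofReal] at h
  exact_mod_cast h

lemma norm_le_supNorm {E : Type*} [NormedAddCommGroup E] {f : ℝ → E} (hf : Continuous f)
    {x : ℝ} (hx : x ∈ Set.Icc (0:ℝ) (2 * Real.pi)) : ‖f x‖ ≤ supNorm f := by
  have hc : Continuous fun y : Set.Icc (0:ℝ) (2 * Real.pi) => ‖f y.1‖ := by fun_prop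
  exact le_ciSup (isCompact_range hc).bddAbove ⟨x, hx⟩

lemma node_mem_Icc {N j : ℕ} (hN : 1 ≤ N) (hj : j ∈ Finset.range (2 * N)) :
    node N j ∈ Set.Icc (0:ℝ) (2 * Real.pi) := by
  have hN0 : (0:ℝ) < N := by exact_mod_cast hN
  have hj' : (j : ℝ) ≤ 2 * N := by exact_mod_cast (Finset.mem_range.mp hj).le
  have hpi := Real.pi_pos
  refine ⟨by unfold node; positivity, ?_⟩
  rw [node, div_le_iff₀ hN0]
  nlinarith

lemma norm_sq_sub_sq_le {a b : ℂ} {M : ℝ} (ha : ‖a‖ ≤ M) (hb : ‖b‖ ≤ M) :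
    ‖a ^ 2 - b ^ 2‖ ≤ 2 * M * ‖a - b‖ := by
  rw [sq_sub_sq, norm_mul]
  have := norm_add_le a b
  gcongr
  linarith

/-- Key nonlinear estimate in the stability proof. -/
theorem nonlinear_term_estimate
    (N : ℕ) (hN : 1 ≤ N) (M : ℝ) (hM : 0 ≤ M)
    (v w : ℝ → ℂ) (hv : memSN N v) (hw : memSN N w)
    (hvd : supNorm (deriv v) ≤ M) (hwd : supNorm (deriv w) ≤ M) :
    ‖∫ x in (0:ℝ)..(2 * Real.pi),
        interp N (fun y => (deriv v y) ^ 2 - (deriv w y) ^ 2) x * (starRingEnd ℂ) (v x - w x)‖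
      ≤ 2 * M * l2norm (deriv (fun x => v x - w x)) * l2norm (fun x => v x - w x) := by
  obtain ⟨a, rfl⟩ := hv
  obtain ⟨b, rfl⟩ := hw
  have hsub : ∀ x, trigPoly N a x - trigPoly N b x = trigPoly N (fun k => a k - b k) x :=
    congrFun (trigPoly_sub N a b)
  simp only [hsub]
  rw [integral_interp_mul_conj N hN, norm_mul, Complex.norm_real, Real.norm_of_nonneg
    (by positivity)]
  have hderiv : ∀ x, deriv (trigPoly N fun k => a k - b k) x =
      deriv (trigPoly N a) x - deriv (trigPoly N b) x := by
    intro x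
    simp only [deriv_trigPoly, congrFun (trigPoly_sub N _ _) x, mul_sub]
  have hbound : ‖∑ j ∈ Finset.range (2 * N),
      ((deriv (trigPoly N a) (node N j)) ^ 2 - (deriv (trigPoly N b) (node N j)) ^ 2) *
        (starRingEnd ℂ) (trigPoly N (fun k => a k - b k) (node N j))‖ ≤
      2 * M * ∑ j ∈ Finset.range (2 * N), ‖deriv (trigPoly N fun k => a k - b k) (node N j)‖ *
        ‖trigPoly N (fun k => a k - b k) (node N j)‖ := by
    rw [Finset.mul_sum]
    refine norm_sum_le_of_le _ fun j hj => ?_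
    have hnode := node_mem_Icc hN hj
    have hcont : ∀ c, Continuous (deriv (trigPoly N c)) := fun c => by
      rw [deriv_trigPoly]; exact continuous_trigPoly N _
    rw [norm_mul, RCLike.norm_conj, ← mul_assoc, hderiv]
    gcongr
    exact norm_sq_sub_sq_le ((norm_le_supNorm (hcont a) hnode).trans hvd)
      ((norm_le_supNorm (hcont b) hnode).trans hwd)
  have hl2 : ∀ c, l2norm (trigPoly N c) = √(Real.pi / N) *
      √(∑ j ∈ Finset.range (2 * N), ‖trigPoly N c (node N j)‖ ^ 2) := fun c => by
    rw [l2norm, integral_norm_sq_trigPoly N hN, Real.sqrt_mul (by positivity)]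
  refine (mul_le_mul_of_nonneg_left hbound (by positivity)).trans ?_
  rw [deriv_trigPoly, hl2, hl2]
  have hcs := Real.sum_mul_le_sqrt_mul_sqrt (Finset.range (2 * N))
    (fun j => ‖trigPoly N (fun k => Complex.I * k * (a k - b k)) (node N j)‖)
    (fun j => ‖trigPoly N (fun k => a k - b k) (node N j)‖)
  have hpi : √(Real.pi / N) * √(Real.pi / N) = Real.pi / N := Real.mul_self_sqrt (by positivity)
  refine (mul_le_mul_of_nonneg_left (mul_le_mul_of_nonneg_left hcs (by positivity))
    (by positivity)).trans_eq ?_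
  generalize √(Real.pi / N) = r at hpi ⊢
  rw [← hpi]
  ring

end
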